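/- For every natural number n and every real x, the normalized Hermite function satisfies |ψ_n(x)| ≤ π^{-1/4}, where ψ_n(x) = e^{-x^2/2} H_n(x) / √(2^n n! √π). -/

import Mathlib

open Real MeasureTheory

/-- The (physicists') Hermite polynomial, via the Rodrigues formula. -/
noncomputable def hermiteH (n : ℕ) (x : ℝ) : ℝ :=
  (-1 : ℝ) ^ n * Real.exp (x ^ 2) * iteratedDeriv n (fun t : ℝ => Real.exp (-t ^ 2)) x

/-- The normalized Hermite function `ψ_n(x) = e^{-x²/2} H_n(x) / √(2ⁿ n! √π)`. -/
noncomputable def hermitePsi (n : ℕ) (x : ℝ) : ℝ :=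
  Real.exp (-x ^ 2 / 2) * hermiteH n x / Real.sqrt (2 ^ n * n.factorial * Real.sqrt π)

open Polynomial in
/-- Physicists' Hermite polynomials as polynomials. -/
noncomputable def pH : ℕ → Polynomial ℝ
  | 0 => 1
  | n + 1 => 2 * X * pH n - derivative (pH n)

open Polynomial in
lemma pH_succ (n : ℕ) : pH (n + 1) = 2 * X * pH n - derivative (pH n) := rfl

open Polynomial in
lemma pH_deriv (n : ℕ) : derivative (pH (n + 1)) = 2 * ((n : Polynomial ℝ) + 1) * pH n := by
  induction n with
  | zero => simp [pH]
  | succ n ih =>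
    rw [pH_succ (n + 1), derivative_sub, derivative_mul, ih, derivative_mul, derivative_mul,
      pH_succ n]
    have h2 : derivative (2 : Polynomial ℝ) = 0 := by
      simp
    have h3 : derivative ((n : Polynomial ℝ) + 1) = 0 := by simp
    simp only [derivative_mul, h2, h3, derivative_X]
    push_cast
    ring

lemma iter_gauss (n : ℕ) : iteratedDeriv n (fun t : ℝ => Real.exp (-t ^ 2)) =
    fun x => (-1 : ℝ) ^ n * (pH n).eval x * Real.exp (-x ^ 2) := by
  induction n with
  | zero => simp [pH]
  | succ n ih =>
    rw [iteratedDeriv_succ, ih]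
    funext x
    have h1 := (pH n).hasDerivAt x
    have h2 : HasDerivAt (fun t : ℝ => Real.exp (-t ^ 2)) (Real.exp (-x ^ 2) * (-(2 * x))) x := by
      have := ((hasDerivAt_pow 2 x).neg).exp
      simpa using this
    have h3 := (h1.const_mul ((-1 : ℝ) ^ n)).mul h2
    refine h3.deriv.trans ?_
    simp [pH_succ, pow_succ]
    ring

lemma hermiteH_eq (n : ℕ) (x : ℝ) : hermiteH n x = (pH n).eval x := by
  rw [hermiteH, iter_gauss]
  have h : Real.exp (x ^ 2) * Real.exp (-x ^ 2) = 1 := by rw [← Real.exp_add]; simp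
  have h2 : (-1 : ℝ) ^ n * (-1) ^ n = 1 := by rw [← mul_pow]; simp
  calc _ = ((-1 : ℝ) ^ n * (-1) ^ n) * (Real.exp (x ^ 2) * Real.exp (-x ^ 2)) * (pH n).eval x := by
        ring
    _ = _ := by rw [h, h2]; ring

/-- Hermite functions normalised so that the bound is `1`. -/
noncomputable def phi (n : ℕ) (x : ℝ) : ℝ :=
  Real.exp (-x ^ 2 / 2) * (pH n).eval x / Real.sqrt (2 ^ n * n.factorial)

lemma norm_succ (n : ℕ) : Real.sqrt (2 ^ (n + 1) * (n + 1).factorial) =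
    Real.sqrt (2 * (n + 1)) * Real.sqrt (2 ^ n * n.factorial) := by
  rw [← Real.sqrt_mul (by positivity)]
  congr 1
  rw [Nat.factorial_succ]
  push_cast
  ring

lemma gauss_deriv (x : ℝ) :
    HasDerivAt (fun t : ℝ => Real.exp (-t ^ 2 / 2)) (Real.exp (-x ^ 2 / 2) * (-x)) x := by
  have := (((hasDerivAt_pow 2 x).neg).div_const 2).exp
  refine this.congr_deriv ?_
  simp
  ring

lemma phi_deriv (n : ℕ) (x : ℝ) :
    HasDerivAt (phi n) (x * phi n x - Real.sqrt (2 * (n + 1)) * phi (n + 1) x) x := by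
  have h := ((gauss_deriv x).mul ((pH n).hasDerivAt x)).div_const (Real.sqrt (2 ^ n * n.factorial))
  refine h.congr_deriv ?_
  have hc : Real.sqrt (2 * ((n : ℝ) + 1)) ≠ 0 := by positivity
  have hN : Real.sqrt (2 ^ n * (n.factorial : ℝ)) ≠ 0 := by positivity
  rw [phi, phi, norm_succ, pH_succ]
  simp only [Polynomial.eval_sub, Polynomial.eval_mul, Polynomial.eval_X, Polynomial.eval_ofNat]
  field_simp
  ring

lemma phi_deriv' (n : ℕ) (x : ℝ) :
    HasDerivAt (phi (n + 1)) (Real.sqrt (2 * (n + 1)) * phi n x - x * phi (n + 1) x) x := by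
  have h := ((gauss_deriv x).mul ((pH (n + 1)).hasDerivAt x)).div_const
    (Real.sqrt (2 ^ (n + 1) * (n + 1).factorial))
  refine h.congr_deriv ?_
  have hc : Real.sqrt (2 * ((n : ℝ) + 1)) ≠ 0 := by positivity
  have hs : Real.sqrt (2 * ((n : ℝ) + 1)) ^ 2 = 2 * (n + 1) := Real.sq_sqrt (by positivity)
  have hN : Real.sqrt (2 ^ n * (n.factorial : ℝ)) ≠ 0 := by positivity
  rw [phi, phi, norm_succ, pH_deriv]
  simp only [Polynomial.eval_add, Polynomial.eval_mul, Polynomial.eval_natCast,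
    Polynomial.eval_one, Polynomial.eval_ofNat]
  field_simp
  rw [hs]
  ring

lemma phi_zero_step (n : ℕ) : |phi (n + 2) 0| ≤ |phi n 0| := by
  have h := (phi_deriv (n + 1) 0).unique (phi_deriv' n 0)
  simp only [zero_mul, zero_sub, sub_zero] at h
  have h' : Real.sqrt (2 * (((n + 1 : ℕ) : ℝ) + 1)) * |phi (n + 2) 0|
      = Real.sqrt (2 * ((n : ℝ) + 1)) * |phi n 0| := by
    have := congrArg abs h
    rwa [abs_neg, abs_mul, abs_mul, abs_of_nonneg (Real.sqrt_nonneg _),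
      abs_of_nonneg (Real.sqrt_nonneg _)] at this
  have hle : Real.sqrt (2 * ((n : ℝ) + 1)) ≤ Real.sqrt (2 * (((n + 1 : ℕ) : ℝ) + 1)) := by
    apply Real.sqrt_le_sqrt; push_cast; linarith
  have hc : 0 < Real.sqrt (2 * (((n + 1 : ℕ) : ℝ) + 1)) := by positivity
  refine le_of_mul_le_mul_left ?_ hc
  rw [h']
  exact mul_le_mul_of_nonneg_right hle (abs_nonneg _)

lemma phi_one_zero : phi 1 0 = 0 := by simp [phi, pH]

lemma phi_zero_le (n : ℕ) : |phi n 0| ≤ 1 ∧ |phi (n + 1) 0| ≤ 1 := by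
  induction n with
  | zero => exact ⟨by simp [phi, pH], by simp [phi_one_zero]⟩
  | succ n ih => exact ⟨ih.2, (phi_zero_step n).trans ih.1⟩

lemma phi_parity (n : ℕ) : phi n 0 * phi (n + 1) 0 = 0 := by
  induction n with
  | zero => simp [phi_one_zero]
  | succ n ih =>
    rcases mul_eq_zero.1 ih with h | h
    · have := phi_zero_step n
      rw [h, abs_zero] at this
      rw [abs_nonpos_iff.1 this, mul_zero]
    · rw [h, zero_mul]

lemma phi_tendsto (n : ℕ) : Filter.Tendsto (phi n) (Filter.cocompact ℝ) (nhds 0) := by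
  have key : ∀ p : Polynomial ℝ, Filter.Tendsto (fun x : ℝ => Real.exp (-x ^ 2 / 2) * p.eval x)
      (Filter.cocompact ℝ) (nhds 0) := by
    intro p
    induction p using Polynomial.induction_on' with
    | add p q hp hq => simpa [mul_add] using hp.add hq
    | monomial k a =>
      have h := tendsto_rpow_abs_mul_exp_neg_mul_sq_cocompact (a := 1 / 2) (by norm_num) (k : ℝ)
      have h2 := h.const_mul |a|
      rw [mul_zero] at h2
      refine squeeze_zero_norm (fun x => le_of_eq ?_) h2
      rw [Real.rpow_natCast, Polynomial.eval_monomial, Real.norm_eq_abs, abs_mul, abs_mul, abs_pow,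
        abs_of_pos (Real.exp_pos _)]
      rw [show -x ^ 2 / 2 = -(1 / 2) * x ^ 2 by ring]
      ring
  have := (key (pH n)).div_const (Real.sqrt (2 ^ n * n.factorial))
  rw [zero_div] at this
  exact this

/-- Core comparison between two consecutive Hermite functions. -/
lemma core (c : ℝ) (hc : 0 < c) (y z : ℝ → ℝ)
    (hy : ∀ t, HasDerivAt y (t * y t - c * z t) t)
    (hz : ∀ t, HasDerivAt z (c * y t - t * z t) t)
    (hyb : ∀ t, |y t| ≤ 1) (h0 : y 0 * z 0 = 0) (x : ℝ) (hx : 0 < x)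
    (hmax : ∀ t, |z t| ≤ z x) : z x ≤ 1 := by
  by_contra hlt
  push Not at hlt
  have hcrit : c * y x - x * z x = 0 := by
    have : IsLocalMax z x := Filter.Eventually.of_forall fun t => (le_abs_self _).trans (hmax t)
    exact this.hasDerivAt_eq_zero (hz x)
  have hyx := (abs_le.1 (hyb x))
  have hxc : x < c := by
    by_contra h
    push Not at h
    nlinarith
  have hyc : Continuous y := continuous_iff_continuousAt.2 fun t => (hy t).continuousAt
  have hzc : Continuous z := continuous_iff_continuousAt.2 fun t => (hz t).continuousAt
  -- the derivative of `y` is negative at `x`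
  have hy'x : x * y x - c * z x < 0 := by
    have : c * (x * y x - c * z x) = (x ^ 2 - c ^ 2) * z x := by linear_combination x * hcrit
    have h2 : (x ^ 2 - c ^ 2) * z x < 0 := mul_neg_of_neg_of_pos (by nlinarith) (by linarith)
    by_contra h
    push Not at h
    have := mul_nonneg hc.le h
    linarith
  have e1 : ∀ᶠ t in nhdsWithin x (Set.Iio x), t * y t - c * z t < 0 := by
    have hcont : Continuous fun t => t * y t - c * z t := by fun_prop
    exact ((hcont.tendsto x).eventually (gt_mem_nhds hy'x)).filter_mono nhdsWithin_le_nhds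
  have e2 : ∀ᶠ t in nhdsWithin x (Set.Iio x), 0 < c * y t - t * z t := by
    have hd : HasDerivAt (fun t => c * y t - t * z t)
        (c * (x * y x - c * z x) - (1 * z x + x * (c * y x - x * z x))) x :=
      ((hy x).const_mul c).sub ((hasDerivAt_id x).mul (hz x))
    have hneg : c * (x * y x - c * z x) - (1 * z x + x * (c * y x - x * z x)) < 0 := by
      rw [hcrit]
      have := mul_neg_of_pos_of_neg hc hy'x
      linarith
    have hs := (hasDerivAt_iff_tendsto_slope.1 hd).eventually (gt_mem_nhds hneg)
    have hs' := hs.filter_mono (nhdsWithin_mono x (fun t (ht : t < x) => ne_of_lt ht))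
    filter_upwards [hs', self_mem_nhdsWithin] with t ht htx
    have htx : t < x := htx
    rw [slope_def_field, hcrit, sub_zero] at ht
    by_contra h
    push Not at h
    have := div_nonneg_of_nonpos h (by linarith : t - x ≤ 0)
    linarith
  obtain ⟨l, hl, hlI⟩ := mem_nhdsLT_iff_exists_Ioo_subset.1 (e1.and e2)
  have hl : l < x := hl
  set K : Set ℝ := Set.Icc 0 l ∩ {t | c * y t - t * z t ≤ 0 ∨ 0 ≤ t * y t - c * z t} with hK
  have hzero : c * y 0 - 0 * z 0 ≤ 0 ∨ 0 ≤ 0 * y 0 - c * z 0 := by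
    rcases mul_eq_zero.1 h0 with h | h
    · left; simp [h]
    · right; simp [h]
  have hl0 : 0 ≤ l := by
    by_contra h
    push Not at h
    have := hlI ⟨h, hx⟩
    rcases hzero with h | h
    · exact absurd this.2 (not_lt.2 h)
    · exact absurd this.1 (not_lt.2 h)
  have hKc : IsCompact K := by
    refine isCompact_Icc.inter_right ?_
    have k1 : IsClosed {t | c * y t - t * z t ≤ 0} := isClosed_le (by fun_prop) (by fun_prop)
    have k2 : IsClosed {t | 0 ≤ t * y t - c * z t} := isClosed_le (by fun_prop) (by fun_prop)
    exact k1.union k2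
  obtain ⟨T, hTK, hTmax⟩ := hKc.exists_isMaxOn ⟨0, ⟨le_refl _, hl0⟩, hzero⟩
    (continuous_id.continuousOn)
  have hTx : T < x := lt_of_le_of_lt hTK.1.2 hl
  have hT0 : 0 ≤ T := hTK.1.1
  have hint : ∀ t ∈ Set.Ioo T x, t * y t - c * z t < 0 ∧ 0 < c * y t - t * z t := by
    intro t ht
    rcases le_or_gt t l with h | h
    · by_contra hcon
      have htK : t ∈ K := by
        refine ⟨⟨by linarith [ht.1], h⟩, ?_⟩
        by_contra h2
        simp only [Set.mem_ofPred_eq, not_or, not_le] at h2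
        exact hcon ⟨h2.2, h2.1⟩
      have : t ≤ T := hTmax htK
      linarith [ht.1]
    · exact hlI ⟨h, ht.2⟩
  have hTcl : T ∈ closure (Set.Ioo T x) := by
    rw [closure_Ioo hTx.ne]; exact ⟨le_refl _, hTx.le⟩
  have hTy : T * y T - c * z T ≤ 0 := by
    have hcl : IsClosed {t | t * y t - c * z t ≤ 0} := isClosed_le (by fun_prop) (by fun_prop)
    exact hcl.closure_subset_iff.2 (fun t ht => (hint t ht).1.le) hTcl
  have hTz : 0 ≤ c * y T - T * z T := by
    have hcl : IsClosed {t | 0 ≤ c * y t - t * z t} := isClosed_le (by fun_prop) (by fun_prop)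
    exact hcl.closure_subset_iff.2 (fun t ht => (hint t ht).2.le) hTcl
  set F : ℝ → ℝ := fun t => (c ^ 2 * (y t ^ 2 + z t ^ 2) - 2 * c * t * y t * z t) / (c ^ 2 - t ^ 2)
    with hF
  have ha : ∀ t ∈ Set.Icc T x, 0 < c ^ 2 - t ^ 2 := by
    intro t ht
    have h1 : 0 ≤ t := hT0.trans ht.1
    have h2 : t < c := lt_of_le_of_lt ht.2 hxc
    nlinarith
  have hFd : ∀ t ∈ Set.Icc T x, HasDerivAt F
      (2 * c * ((t * y t - c * z t) * (c * y t - t * z t)) / (c ^ 2 - t ^ 2) ^ 2) t := by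
    intro t ht
    have hne := (ha t ht).ne'
    have hn := ((((hy t).pow 2).add ((hz t).pow 2)).const_mul (c ^ 2)).sub
      ((((hasDerivAt_id t).const_mul (2 * c)).mul (hy t)).mul (hz t))
    have hdn := ((hasDerivAt_pow 2 t).const_sub (c ^ 2))
    have := hn.div hdn hne
    refine this.congr_deriv ?_
    simp
    field_simp
    ring
  have hanti : StrictAntiOn F (Set.Icc T x) := by
    refine strictAntiOn_of_deriv_neg (convex_Icc T x)
      (fun t ht => (hFd t ht).continuousAt.continuousWithinAt) ?_
    intro t ht
    rw [interior_Icc] at ht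
    rw [(hFd t (Set.Ioo_subset_Icc_self ht)).deriv]
    have h1 := hint t ht
    have h2 := ha t (Set.Ioo_subset_Icc_self ht)
    refine div_neg_of_neg_of_pos ?_ (by positivity)
    exact mul_neg_of_pos_of_neg (by positivity) (mul_neg_of_neg_of_pos h1.1 h1.2)
  have hFlt : F x < F T := hanti ⟨le_refl _, hTx.le⟩ ⟨hTx.le, le_refl _⟩ hTx
  have hFz : ∀ t ∈ Set.Icc T x, c * y t - t * z t = 0 → F t = z t ^ 2 := by
    intro t ht h
    have hne := (ha t ht).ne'
    simp only [hF]
    rw [div_eq_iff hne]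
    linear_combination (c * y t - t * z t) * h
  have hFy : ∀ t ∈ Set.Icc T x, t * y t - c * z t = 0 → F t = y t ^ 2 := by
    intro t ht h
    have hne := (ha t ht).ne'
    simp only [hF]
    rw [div_eq_iff hne]
    linear_combination (t * y t - c * z t) * h
  rw [hFz x ⟨hTx.le, le_refl _⟩ hcrit] at hFlt
  rcases hTK.2 with h | h
  · rw [hFz T ⟨le_refl _, hTx.le⟩ (le_antisymm h hTz)] at hFlt
    have := hmax T
    have h3 : z T ^ 2 ≤ z x ^ 2 := by
      rw [← sq_abs (z T)]
      exact pow_le_pow_left₀ (abs_nonneg _) this 2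
    linarith
  · rw [hFy T ⟨le_refl _, hTx.le⟩ (le_antisymm hTy h)] at hFlt
    have h3 : y T ^ 2 ≤ 1 := by
      rw [← sq_abs (y T)]
      exact pow_le_one₀ (abs_nonneg _) (hyb T)
    nlinarith

lemma core_abs (c : ℝ) (hc : 0 < c) (y z : ℝ → ℝ)
    (hy : ∀ t, HasDerivAt y (t * y t - c * z t) t)
    (hz : ∀ t, HasDerivAt z (c * y t - t * z t) t)
    (hyb : ∀ t, |y t| ≤ 1) (h0 : y 0 * z 0 = 0) (x : ℝ) (hx : 0 < x)
    (hmax : ∀ t, |z t| ≤ |z x|) : |z x| ≤ 1 := by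
  rcases abs_cases (z x) with h | h
  · rw [h.1] at hmax ⊢
    exact core c hc y z hy hz hyb h0 x hx hmax
  · rw [h.1] at hmax ⊢
    refine core c hc (fun t => -y t) (fun t => -z t) (fun t => ?_) (fun t => ?_) (fun t => ?_) ?_
      x hx (fun t => ?_)
    · exact (hy t).neg.congr_deriv (by ring)
    · exact (hz t).neg.congr_deriv (by ring)
    · rw [abs_neg]; exact hyb t
    · simpa using h0
    · rw [abs_neg]; exact hmax t

lemma core_full (c : ℝ) (hc : 0 < c) (y z : ℝ → ℝ)
    (hy : ∀ t, HasDerivAt y (t * y t - c * z t) t)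
    (hz : ∀ t, HasDerivAt z (c * y t - t * z t) t)
    (hyb : ∀ t, |y t| ≤ 1) (h0 : y 0 * z 0 = 0) (hz0 : |z 0| ≤ 1) (x : ℝ)
    (hmax : ∀ t, |z t| ≤ |z x|) : |z x| ≤ 1 := by
  rcases lt_trichotomy x 0 with h | h | h
  · have := core_abs c hc (fun t => -y (-t)) (fun t => z (-t)) (fun t => ?_) (fun t => ?_)
      (fun t => ?_) ?_ (-x) (by linarith) (fun t => ?_)
    · simpa using this
    · have h1 := ((hy (-t)).scomp t (hasDerivAt_neg t)).neg
      exact h1.congr_deriv (by simp; ring)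
    · have h1 := ((hz (-t)).scomp t (hasDerivAt_neg t))
      exact h1.congr_deriv (by simp; ring)
    · rw [abs_neg]; exact hyb _
    · simpa using h0
    · simpa using hmax (-t)
  · rw [h]; exact hz0
  · exact core_abs c hc y z hy hz hyb h0 x h hmax

lemma phi_le (n : ℕ) : ∀ x, |phi n x| ≤ 1 := by
  induction n with
  | zero =>
    intro x
    simp only [phi, pH]
    simp only [Polynomial.eval_one, pow_zero, Nat.factorial_zero, Nat.cast_one, mul_one,
      Real.sqrt_one, div_one, abs_of_pos (Real.exp_pos _)]
    rw [Real.exp_le_one_iff]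
    nlinarith [sq_nonneg x]
  | succ n ih =>
    have hcont : Continuous (phi (n + 1)) :=
      continuous_iff_continuousAt.2 fun t => (phi_deriv' n t).continuousAt
    have hmax : ∃ x, ∀ t, |phi (n + 1) t| ≤ |phi (n + 1) x| := by
      by_cases hall : ∀ t, phi (n + 1) t = 0
      · exact ⟨0, fun t => by simp [hall]⟩
      push Not at hall
      obtain ⟨t0, ht0⟩ := hall
      have ht := (phi_tendsto (n + 1)).abs
      rw [abs_zero] at ht
      exact hcont.abs.exists_forall_ge' t0
        ((ht.eventually (gt_mem_nhds (abs_pos.2 ht0))).mono fun t h => h.le)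
    obtain ⟨x, hx⟩ := hmax
    intro t
    exact (hx t).trans (core_full (Real.sqrt (2 * (n + 1))) (by positivity) (phi n) (phi (n + 1))
      (phi_deriv n) (phi_deriv' n) ih (phi_parity n) (phi_zero_le n).2 x hx)

theorem hermite_function_uniform_bound (n : ℕ) (x : ℝ) :
    |hermitePsi n x| ≤ π ^ (-(1 : ℝ) / 4) := by
  have h : hermitePsi n x = phi n x * π ^ (-(1 : ℝ) / 4) := by
    have hs : Real.sqrt (Real.sqrt π) = π ^ ((1 : ℝ) / 4) := by
      rw [Real.sqrt_eq_rpow, Real.sqrt_eq_rpow, ← Real.rpow_mul Real.pi_pos.le]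
      norm_num
    rw [hermitePsi, phi, hermiteH_eq, Real.sqrt_mul (by positivity), hs, neg_div (4 : ℝ) 1,
      Real.rpow_neg Real.pi_pos.le, ← div_eq_mul_inv, div_div]
  have hp : 0 < π ^ (-(1 : ℝ) / 4) := Real.rpow_pos_of_pos Real.pi_pos _
  rw [h, abs_mul, abs_of_pos hp]
  exact mul_le_of_le_one_left hp.le (phi_le n x)
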